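/- Let D ⊆ F_{q^m}^* be a proper F_q^*-invariant partial difference set with parameters (q^m, k, λ, μ) whose restricted eigenvalues θ1 > 0 > θ2 (i.e., Ψ_a(D) ∈ {θ1, θ2} for all a ∈ F_{q^m}^*) satisfy conditions (1) k − θ2 ≠ q^m, (2) k > θ1 and k > −(q−1)θ2, and at least one of (3a) k < q^m + qθ2 − (q−1)θ1, (3b) k > max(qθ0 + θ1, qθ0 − (q−1)θ2) where θ0 = max(|θ1|, |θ2|), (3c) q^{m−1} + θ2 − θ1 > θ0. If moreover k ≤ (q−1)²·q^{m−2} and the characteristic function f_D is not linear, then C(M_D) is a minimal linear code of length q^m − 1 and dimension m + 1 over F_q whose minimum and maximum nonzero weights satisfy w_min / w_max ≤ (q−1)/q (so C(M_D) does not satisfy the Ashikhmin–Barg condition). -/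

import Mathlib

/-- The canonical additive character of a finite field `K` of characteristic
`p`:  `Ψ(x) = exp(2πi·Tr_{K/F_p}(x)/p)`. -/
noncomputable def canonAddChar (p : ℕ) (K : Type*) [Field K] [CharP K p] (x : K) : ℂ :=
  letI := ZMod.algebra K p
  Complex.exp (2 * Real.pi * Complex.I * ((Algebra.trace (ZMod p) K x).val : ℂ) / p)

/-- The codeword `c(u,v)` of the code `C(M_D)`. -/
noncomputable def codewordMD (F E : Type*) [Field F] [Field E] [DecidableEq E] [Algebra F E]
    (D : Finset E) (w : F × E) : {x : E // x ≠ 0} → F :=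
  fun x => w.1 * (if (x : E) ∈ D then (1 : F) else 0) + Algebra.trace F E (w.2 * (x : E))

section TraceForm

variable {F E : Type*} [Field F] [Field E] [Finite E] [Algebra F E]

lemma exists_trace_mul_ne_zero {v : E} (hv : v ≠ 0) :
    ∃ x : E, Algebra.trace F E (v * x) ≠ 0 := by
  have : Finite F := Finite.of_injective _ (algebraMap F E).injective
  by_contra! hf
  exact hv ((traceForm_nondegenerate F E).1 v hf)

/-- If the kernel of `x ↦ Tr(vx)` lies in that of `x ↦ Tr(v'x)`, then `v'` is a multiple of `v`. -/
lemma exists_eq_algebraMap_mul_of_trace {v v' : E} (hv : v ≠ 0)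
    (h : ∀ x : E, Algebra.trace F E (v * x) = 0 → Algebra.trace F E (v' * x) = 0) :
    ∃ b : F, v' = algebraMap F E b * v := by
  obtain ⟨y, hy⟩ := exists_trace_mul_ne_zero (F := F) hv
  refine ⟨Algebra.trace F E (v' * y) / Algebra.trace F E (v * y), ?_⟩
  by_contra hne
  obtain ⟨x, hx⟩ := exists_trace_mul_ne_zero (F := F) (sub_ne_zero.2 hne)
  apply hx
  have h0 := h (x - (Algebra.trace F E (v * x) / Algebra.trace F E (v * y)) • y) (by
    rw [mul_sub, map_sub, mul_smul_comm, map_smul, smul_eq_mul, div_mul_cancel₀ _ hy, sub_self])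
  rw [mul_sub, map_sub, mul_smul_comm, map_smul, smul_eq_mul] at h0
  rw [sub_mul, map_sub, mul_assoc, ← Algebra.smul_def, map_smul, smul_eq_mul]
  field_simp at h0 ⊢
  linear_combination h0

end TraceForm

section Counting

open Finset

lemma card_filter_eq_zero_mul_card {R V W : Type*} [AddCommGroup V] [AddCommGroup W] [Ring R]
    [Module R V] [Module R W] [Fintype V] [Fintype W] [DecidableEq W] (L : V →ₗ[R] W)
    (hL : Function.Surjective L) :
    #{x : V | L x = 0} * Fintype.card W = Fintype.card V := by
  have h := Submodule.card_eq_card_quotient_mul_card (LinearMap.ker L)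
  rw [Nat.card_congr (L.quotKerEquivOfSurjective hL).toEquiv] at h
  rw [← Nat.card_eq_fintype_card, ← Nat.card_eq_fintype_card, h, ← Fintype.card_subtype,
    ← Nat.card_eq_fintype_card]
  rfl

variable {F E : Type*} [Field F] [Field E] [Fintype F] [Fintype E] [DecidableEq F] [Algebra F E]

lemma card_trace_mul_eq_zero {v : E} (hv : v ≠ 0) :
    #{x : E | Algebra.trace F E (v * x) = 0} * Fintype.card F = Fintype.card E := by
  refine card_filter_eq_zero_mul_card (Algebra.traceForm F E v) fun a => ?_
  obtain ⟨y, hy⟩ := exists_trace_mul_ne_zero (F := F) hv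
  exact ⟨(a / Algebra.trace F E (v * y)) • y, by
    rw [map_smul, Algebra.traceForm_apply, smul_eq_mul, div_mul_cancel₀ _ hy]⟩

lemma card_trace_mul_eq_zero_and {v v' : E} (hv : v ≠ 0)
    (h : ∃ x, Algebra.trace F E (v * x) = 0 ∧ Algebra.trace F E (v' * x) ≠ 0) :
    #{x : E | Algebra.trace F E (v * x) = 0 ∧ Algebra.trace F E (v' * x) = 0} *
      Fintype.card F ^ 2 = Fintype.card E := by
  have := card_filter_eq_zero_mul_card
    ((Algebra.traceForm F E v).prod (Algebra.traceForm F E v')) ?_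
  · rw [← this, Fintype.card_prod, sq]
    congr 2
    ext x
    simp [Prod.ext_iff]
  · rintro ⟨a, b⟩
    obtain ⟨y, hy⟩ := exists_trace_mul_ne_zero (F := F) hv
    obtain ⟨x, hx, hx'⟩ := h
    simp only [← Algebra.traceForm_apply] at hx hx' hy
    refine ⟨(a / Algebra.traceForm F E v y) • y + ((b - (a / Algebra.traceForm F E v y) *
      Algebra.traceForm F E v' y) / Algebra.traceForm F E v' x) • x, ?_⟩
    simp [-Algebra.traceForm_apply, hx, hx', hy]

lemma card_trace_mul_eq_zero_ne_zero {v v' : E} (hv : v ≠ 0)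
    (h : ∃ x, Algebra.trace F E (v * x) = 0 ∧ Algebra.trace F E (v' * x) ≠ 0) :
    (#{x : E | Algebra.trace F E (v * x) = 0 ∧ Algebra.trace F E (v' * x) ≠ 0} : ℝ) *
      Fintype.card F ^ 2 = (Fintype.card F - 1) * Fintype.card E := by
  have h1 := card_trace_mul_eq_zero (F := F) hv
  have h2 := card_trace_mul_eq_zero_and (F := F) hv h
  have h3 := card_filter_add_card_filter_not
    (s := ({x : E | Algebra.trace F E (v * x) = 0} : Finset E))
    (fun x => Algebra.trace F E (v' * x) = 0)
  rw [filter_filter, filter_filter] at h3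
  rify at h1 h2 h3
  linear_combination (Fintype.card F : ℝ) ^ 2 * h3 + Fintype.card F * h1 - h2

lemma card_trace_mul_ne_zero {v : E} (hv : v ≠ 0) :
    (#{x : E | Algebra.trace F E (v * x) ≠ 0} : ℝ) * Fintype.card F =
      (Fintype.card F - 1) * Fintype.card E := by
  have h1 := card_trace_mul_eq_zero (F := F) hv
  have h3 := card_filter_add_card_filter_not (s := (univ : Finset E))
    (fun x => Algebra.trace F E (v * x) = 0)
  rw [card_univ] at h3
  rify at h1 h3
  linear_combination (Fintype.card F : ℝ) * h3 - h1

end Counting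

section Characters

open Finset

variable {F E : Type*} [Field F] [Field E] [Fintype F] [Fintype E] [DecidableEq F] [Algebra F E]

lemma sum_canonAddChar_algebraMap_mul (p : ℕ) [Fact p.Prime] [CharP E p] (y : E) :
    ∑ l : F, canonAddChar p E (algebraMap F E l * y) =
      if Algebra.trace F E y = 0 then (Fintype.card F : ℂ) else 0 := by
  classical
  have : CharP F p := (algebraMap F E).charP (algebraMap F E).injective p
  let := ZMod.algebra E p
  let := ZMod.algebra F p
  have : IsScalarTower (ZMod p) F E := IsScalarTower.of_algebraMap_eq' (Subsingleton.elim _ _)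
  have : Module.Finite (ZMod p) F := Module.Finite.of_finite
  have : Module.Finite F E := Module.Finite.of_finite
  let ψ : AddChar F ℂ := ZMod.stdAddChar.compAddMonoidHom
    ((Algebra.trace (ZMod p) F).toAddMonoidHom.comp
      (AddMonoidHom.mulRight (Algebra.trace F E y)))
  have hψ (l : F) : canonAddChar p E (algebraMap F E l * y) = ψ l := by
    change _ = ZMod.stdAddChar (Algebra.trace (ZMod p) F (l * Algebra.trace F E y))
    rw [← smul_eq_mul l, ← map_smul, Algebra.trace_trace, Algebra.smul_def]
    simp only [canonAddChar]
    conv_rhs => rw [← ZMod.natCast_zmod_val (Algebra.trace (ZMod p) E (algebraMap F E l * y))]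
    exact (ZMod.stdAddChar_coe (N := p) _).symm.trans (by simp)
  simp_rw [hψ]
  rw [AddChar.sum_eq_ite]
  refine if_congr ⟨fun h => ?_, fun h => ?_⟩ rfl rfl
  · by_contra hne
    obtain ⟨a, ha⟩ := exists_trace_mul_ne_zero (F := ZMod p) hne
    have h1 : ψ a = 1 := by rw [h]; rfl
    change ZMod.stdAddChar (Algebra.trace (ZMod p) F (a * Algebra.trace F E y)) = 1 at h1
    rw [← AddChar.map_zero_eq_one (ZMod.stdAddChar (N := p))] at h1
    rw [mul_comm] at ha
    exact ha (ZMod.injective_stdAddChar h1)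
  · ext l
    change ZMod.stdAddChar (Algebra.trace (ZMod p) F (l * Algebra.trace F E y)) = 1
    rw [h, mul_zero, map_zero, AddChar.map_zero_eq_one]

/-- The eigenvalue `Ψ_v(D)` of an `F^*`-invariant set determines how many `x ∈ D` have
`Tr(vx) = 0`. -/
lemma card_mul_card_filter_trace_eq {p : ℕ} [Fact p.Prime] [CharP E p] {D : Finset E}
    (hinv : ∀ l : F, l ≠ 0 → ∀ x ∈ D, algebraMap F E l * x ∈ D) {v : E} {θ : ℝ}
    (hθ : ∑ x ∈ D, canonAddChar p E (v * x) = (θ : ℂ)) :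
    (Fintype.card F : ℝ) * #{x ∈ D | Algebra.trace F E (v * x) = 0} =
      #D + (Fintype.card F - 1) * θ := by
  have h1 : ∑ l : F, ∑ x ∈ D, canonAddChar p E (algebraMap F E l * (v * x)) =
      (Fintype.card F : ℂ) * #{x ∈ D | Algebra.trace F E (v * x) = 0} := by
    rw [sum_comm]
    simp_rw [sum_canonAddChar_algebraMap_mul]
    rw [← sum_filter, sum_const, nsmul_eq_mul, mul_comm]
  have h2 (l : F) (hl : l ∈ univ.erase (0 : F)) :
      ∑ x ∈ D, canonAddChar p E (algebraMap F E l * (v * x)) = θ := by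
    have hl0 : l ≠ 0 := ne_of_mem_erase hl
    have hl1 : algebraMap F E l ≠ 0 := by simpa using hl0
    rw [← hθ]
    refine sum_nbij' (fun x => algebraMap F E l * x) (fun x => algebraMap F E l⁻¹ * x)
      (fun x hx => hinv l hl0 x hx) (fun x hx => hinv _ (inv_ne_zero hl0) x hx) ?_ ?_ ?_
    · intro x _
      simp [hl1]
    · intro x _
      simp [hl1]
    · intro x _
      rw [mul_left_comm]
  rw [← add_sum_erase _ _ (mem_univ (0 : F)), sum_congr rfl h2] at h1
  have hz : canonAddChar p E 0 = 1 := by simp [canonAddChar]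
  simp only [map_zero, zero_mul, hz, sum_const, nsmul_eq_mul, mul_one,
    card_erase_of_mem (mem_univ _), card_univ, Nat.cast_sub (Fintype.card_pos (α := F)), Nat.cast_one] at h1
  exact_mod_cast h1.symm

end Characters

section Minimality

open Finset

variable {F E : Type*} [Field F] [Field E] [Fintype F] [Fintype E] [DecidableEq F] [DecidableEq E]
  [Algebra F E] {D : Finset E}

/-- No codeword `c(u', v')` with `u' ≠ 0` vanishes wherever the codeword `c(0, v)` does. -/
lemma exists_trace_eq_zero_and_codeword_ne_zero
    (hinv : ∀ l : F, l ≠ 0 → ∀ x ∈ D, algebraMap F E l * x ∈ D) {u' : F} {v v' : E} {θ : ℝ}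
    (hu' : u' ≠ 0) (hv : v ≠ 0)
    (hcount : (Fintype.card F : ℝ) * #{x ∈ D | Algebra.trace F E (v * x) = 0} =
      #D + (Fintype.card F - 1) * θ)
    (hlt : θ < #D) (hlt' : -((Fintype.card F - 1) * θ) < #D)
    (hk : (Fintype.card F : ℝ) ^ 2 * #D ≤ (Fintype.card F - 1) ^ 2 * Fintype.card E) :
    ∃ x, Algebra.trace F E (v * x) = 0 ∧
      u' * (if x ∈ D then 1 else 0) + Algebra.trace F E (v' * x) ≠ 0 := by
  by_contra! h
  have hq : (1 : ℝ) < Fintype.card F := by exact_mod_cast Fintype.one_lt_card (α := F)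
  have hmem {x : E} (hx : Algebra.trace F E (v * x) = 0) :
      x ∈ D ↔ Algebra.trace F E (v' * x) ≠ 0 := by
    have := h x hx
    by_cases hD : x ∈ D <;> simp only [hD, if_true, if_false, mul_one, mul_zero, zero_add] at this
    · refine iff_of_true hD fun h0 => hu' ?_
      rwa [h0, add_zero] at this
    · exact iff_of_false hD (not_not.2 this)
  by_cases hx : ∃ x, Algebra.trace F E (v * x) = 0 ∧ Algebra.trace F E (v' * x) ≠ 0
  · have hcard := card_trace_mul_eq_zero_ne_zero hv hx
    obtain ⟨x, hx, hx'⟩ := hx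
    have hxD := (hmem hx).2 hx'
    have hall (l : F) (hl : l ≠ 0) : l = 1 := by
      have h1 := h x hx
      have h2 := h (algebraMap F E l * x) (by
        rw [mul_left_comm, ← Algebra.smul_def, map_smul, hx, smul_zero])
      rw [if_pos hxD] at h1
      rw [if_pos (hinv l hl x hxD), mul_left_comm, ← Algebra.smul_def, map_smul, smul_eq_mul] at h2
      have : (l - 1) * Algebra.trace F E (v' * x) = 0 := by linear_combination h2 - h1
      exact sub_eq_zero.1 ((mul_eq_zero.1 this).resolve_right hx')
    have hq2 : Fintype.card F = 2 := by
      refine le_antisymm ?_ (Fintype.one_lt_card (α := F))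
      have : (univ : Finset F) ⊆ {0, 1} := fun l _ => by
        by_cases hl : l = 0
        · simp [hl]
        · simp [hall l hl]
      exact (card_le_card this).trans card_le_two
    have heq : #{x ∈ D | Algebra.trace F E (v * x) = 0} =
        #{x : E | Algebra.trace F E (v * x) = 0 ∧ Algebra.trace F E (v' * x) ≠ 0} := by
      congr 1
      ext y
      simp only [mem_filter, mem_univ, true_and]
      exact ⟨fun hy => ⟨hy.2, (hmem hy.2).1 hy.1⟩, fun hy => ⟨(hmem hy.1).2 hy.2, hy.1⟩⟩
    rw [heq] at hcount
    rw [hq2] at hcount hcard hk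
    push_cast at hcount hcard hk
    linarith
  · push Not at hx
    have hempty : ({x ∈ D | Algebra.trace F E (v * x) = 0} : Finset E) = ∅ :=
      filter_eq_empty_iff.2 fun x hxD h0 => (hmem h0).1 hxD (hx x h0)
    rw [hempty, card_empty] at hcount
    push_cast at hcount
    linarith

/-- If `u ≠ 0`, every codeword `c(0, v')` that vanishes wherever `c(u, v)` does is trivial. -/
lemma eq_zero_of_forall_codeword_eq_zero
    (hinv : ∀ l : F, l ≠ 0 → ∀ x ∈ D, algebraMap F E l * x ∈ D) {u : F} {v v' : E} {θ1 θ2 : ℝ}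
    (hcount : ∀ w : E, w ≠ 0 → ∃ θ : ℝ, (θ = θ1 ∨ θ = θ2) ∧
      (Fintype.card F : ℝ) * #{x ∈ D | Algebra.trace F E (w * x) = 0} =
        #D + (Fintype.card F - 1) * θ)
    (hθ1 : 0 < θ1) (hθ2 : θ2 < 0) (hlt : θ1 < #D) (hcard : #D < Fintype.card E)
    (h1 : (#D : ℝ) - θ2 ≠ Fintype.card E)
    (h3 : (#D : ℝ) < Fintype.card E + Fintype.card F * θ2 - (Fintype.card F - 1) * θ1 ∨
      (#D : ℝ) > Fintype.card F * max |θ1| |θ2| + θ1 ∨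
      (Fintype.card E : ℝ) / Fintype.card F + θ2 - θ1 > max |θ1| |θ2|)
    (hu : u ≠ 0)
    (h : ∀ x, u * (if x ∈ D then 1 else 0) + Algebra.trace F E (v * x) = 0 →
      Algebra.trace F E (v' * x) = 0) : v' = 0 := by
  by_contra hv'
  have hq : (1 : ℝ) < Fintype.card F := by exact_mod_cast Fintype.one_lt_card (α := F)
  have hQ : (0 : ℝ) < Fintype.card E := by exact_mod_cast Fintype.card_pos (α := E)
  have hnotMem {x : E} (hx : Algebra.trace F E (v * x) = 0)
      (hx' : Algebra.trace F E (v' * x) ≠ 0) : x ∈ D := by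
    by_contra hD
    exact hx' (h x (by rw [if_neg hD, hx, mul_zero, add_zero]))
  have hmem {x : E} (hD : x ∈ D) (hx : Algebra.trace F E (v * x) ≠ 0) :
      Algebra.trace F E (v' * x) = 0 := by
    have hl : -u / Algebra.trace F E (v * x) ≠ 0 := div_ne_zero (neg_ne_zero.2 hu) hx
    have := h (algebraMap F E (-u / Algebra.trace F E (v * x)) * x) (by
      rw [if_pos (hinv _ hl x hD), mul_left_comm, ← Algebra.smul_def, map_smul, smul_eq_mul,
        div_mul_cancel₀ _ hx, mul_one, add_neg_cancel])
    rw [mul_left_comm, ← Algebra.smul_def, map_smul, smul_eq_mul] at this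
    exact (mul_eq_zero.1 this).resolve_left hl
  have hsplit (w : E) := card_filter_add_card_filter_not (s := D)
    (fun x => Algebra.trace F E (w * x) = 0)
  by_cases hv : v = 0
  · subst hv
    simp only [zero_mul, map_zero, ne_eq, forall_const] at hnotMem
    obtain ⟨θ, hθ, hn⟩ := hcount v' hv'
    have heq : #{x ∈ D | ¬ Algebra.trace F E (v' * x) = 0} =
        #{x : E | Algebra.trace F E (v' * x) ≠ 0} := by
      congr 1
      ext x
      simp only [mem_filter, mem_univ, true_and]
      exact ⟨fun hx => hx.2, fun hx => ⟨hnotMem hx, hx⟩⟩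
    have hc := card_trace_mul_ne_zero (F := F) hv'
    have hs := hsplit v'
    rw [heq] at hs
    rify at hs hcard
    have : ((Fintype.card F : ℝ) - 1) * (#D - θ - Fintype.card E) = 0 := by
      linear_combination (Fintype.card F : ℝ) * (-hs) + hn + hc
    have := (mul_eq_zero.1 this).resolve_left (by linarith)
    rcases hθ with rfl | rfl
    · linarith
    · exact h1 (by linarith)
  have hsub : ∃ x ∈ D, Algebra.trace F E (v * x) ≠ 0 := by
    by_contra! hall
    obtain ⟨θ, hθ, hn⟩ := hcount v hv
    rw [filter_true_of_mem hall] at hn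
    have : ((Fintype.card F : ℝ) - 1) * (#D - θ) = 0 := by linear_combination hn
    have := (mul_eq_zero.1 this).resolve_left (by linarith)
    rcases hθ with rfl | rfl <;> linarith
  have hx₁ : ∃ x, Algebra.trace F E (v' * x) = 0 ∧ Algebra.trace F E (v * x) ≠ 0 := by
    obtain ⟨x, hxD, hx⟩ := hsub
    exact ⟨x, hmem hxD hx, hx⟩
  have hx₂ : ∃ x, Algebra.trace F E (v * x) = 0 ∧ Algebra.trace F E (v' * x) ≠ 0 := by
    by_contra! hall
    obtain ⟨b, rfl⟩ := exists_eq_algebraMap_mul_of_trace hv hall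
    obtain ⟨x, hx, hx'⟩ := hx₁
    have hb : b ≠ 0 := fun hb => hv' (by rw [hb, map_zero, zero_mul])
    rw [mul_assoc, ← Algebra.smul_def, map_smul, smul_eq_mul] at hx
    exact hx' ((mul_eq_zero.1 hx).resolve_left hb)
  have hw : v + v' ≠ 0 := by
    intro h0
    obtain ⟨x, hx, hx'⟩ := hx₁
    apply hx'
    rw [eq_neg_of_add_eq_zero_left h0, neg_mul, map_neg, hx, neg_zero]
  have hc₁ := card_trace_mul_eq_zero_ne_zero hv' hx₁
  have hc₂ := card_trace_mul_eq_zero_ne_zero hv hx₂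
  have hnv : #{x ∈ D | Algebra.trace F E (v * x) = 0} =
      #{x ∈ D | Algebra.trace F E ((v + v') * x) = 0} +
        #{x : E | Algebra.trace F E (v * x) = 0 ∧ Algebra.trace F E (v' * x) ≠ 0} := by
    rw [← card_filter_add_card_filter_not (s := ({x ∈ D | Algebra.trace F E (v * x) = 0}))
      (fun x => Algebra.trace F E (v' * x) = 0), filter_filter, filter_filter]
    congr 2
    · ext x
      simp only [mem_filter, add_mul, map_add]
      refine and_congr_right fun hD => ⟨fun hx => by rw [hx.1, hx.2, add_zero], fun hx => ?_⟩
      by_cases h0 : Algebra.trace F E (v * x) = 0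
      · exact ⟨h0, by rwa [h0, zero_add] at hx⟩
      · rw [hmem hD h0, add_zero] at hx
        exact absurd hx h0
    · ext x
      simp only [mem_filter, mem_univ, true_and]
      exact ⟨fun hx => hx.2, fun hx => ⟨hnotMem hx.1 hx.2, hx⟩⟩
  have hle : #{x ∈ D | ¬ Algebra.trace F E (v * x) = 0} ≤
      #{x : E | Algebra.trace F E (v' * x) = 0 ∧ Algebra.trace F E (v * x) ≠ 0} := by
    refine card_le_card fun x hx => ?_
    simp only [mem_filter, mem_univ, true_and] at hx ⊢
    exact ⟨hmem hx.1 hx.2, hx.2⟩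
  have hs := hsplit v
  obtain ⟨θ, hθ, hn⟩ := hcount v hv
  obtain ⟨θ', hθ', hn'⟩ := hcount (v + v') hw
  rify at hnv hle hs
  set q : ℝ := (Fintype.card F : ℝ)
  set Q : ℝ := (Fintype.card E : ℝ)
  have hq0 : q ≠ 0 := by positivity
  have hdiff : θ - θ' = Q / q := by
    rw [eq_div_iff hq0]
    refine mul_left_cancel₀ (sub_ne_zero.2 hq.ne') ?_
    linear_combination q ^ 2 * hnv - q * hn + q * hn' + hc₂
  have hpos : 0 < Q / q := by positivity
  obtain ⟨rfl, rfl⟩ : θ = θ1 ∧ θ' = θ2 := by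
    rcases hθ with rfl | rfl <;> rcases hθ' with rfl | rfl
    · linarith
    · exact ⟨rfl, rfl⟩
    · linarith
    · linarith
  have hkθ : #D - θ ≤ Q / q := by
    rw [le_div_iff₀ (by positivity)]
    refine le_of_mul_le_mul_left ?_ (sub_pos.2 hq)
    nlinarith [mul_le_mul_of_nonneg_left hle (sq_nonneg q)]
  have hQq : Q = q * (Q / q) := by field_simp
  have hm1 := (le_abs_self θ).trans (le_max_left |θ| |θ'|)
  have hm2 := (neg_le_abs θ').trans (le_max_right |θ| |θ'|)
  rcases h3 with h3 | h3 | h3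
  · rw [hQq, ← hdiff] at h3
    linarith
  · have : 2 ≤ q := Nat.ofNat_le_cast.2 (Fintype.one_lt_card (α := F))
    nlinarith
  · linarith

end Minimality

section Codewords

open Finset

variable {F E : Type*} [Field F] [Field E] [DecidableEq E] [Algebra F E]

/-- The `F`-linear parametrization `(u, v) ↦ c(u, v)` of the code `C(M_D)`. -/
noncomputable def codewordMDLinearMap (F : Type*) {E : Type*} [Field F] [Field E] [DecidableEq E]
    [Algebra F E] (D : Finset E) : F × E →ₗ[F] ({x : E // x ≠ 0} → F) where
  toFun := codewordMD F E D
  map_add' w w' := by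
    ext x
    simp only [codewordMD, Prod.fst_add, Prod.snd_add, add_mul, map_add, Pi.add_apply]
    ring
  map_smul' a w := by
    ext x
    simp only [codewordMD, Prod.smul_fst, Prod.smul_snd, smul_mul_assoc, map_smul, smul_eq_mul,
      Pi.smul_apply, RingHom.id_apply]
    ring

lemma codewordMD_eq_zero_iff {D : Finset E} (hD0 : ∀ x ∈ D, x ≠ 0) {w : F × E} :
    codewordMD F E D w = 0 ↔
      ∀ x : E, w.1 * (if x ∈ D then 1 else 0) + Algebra.trace F E (w.2 * x) = 0 := by
  refine ⟨fun h x => ?_, fun h => funext fun x => h x⟩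
  by_cases hx : x = 0
  · have : x ∉ D := fun hD => hD0 x hD hx
    rw [if_neg this, hx, mul_zero, mul_zero, map_zero, add_zero]
  · exact congrFun h ⟨x, hx⟩

lemma codewordMD_support_subset {D : Finset E} (hD0 : ∀ x ∈ D, x ≠ 0) {w w' : F × E}
    (h : Function.support (codewordMD F E D w') ⊆ Function.support (codewordMD F E D w)) (x : E)
    (hx : w.1 * (if x ∈ D then 1 else 0) + Algebra.trace F E (w.2 * x) = 0) :
    w'.1 * (if x ∈ D then 1 else 0) + Algebra.trace F E (w'.2 * x) = 0 := by
  by_cases hx0 : x = 0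
  · have : x ∉ D := fun hD => hD0 x hD hx0
    rw [if_neg this, hx0, mul_zero, mul_zero, map_zero, add_zero]
  · by_contra hne
    exact h (a := ⟨x, hx0⟩) hne hx

variable [Fintype E] [DecidableEq F]

lemma codewordMDLinearMap_injective {D : Finset E} (hD0 : ∀ x ∈ D, x ≠ 0)
    (hnl : ∃ x y : E, x ≠ 0 ∧ y ≠ 0 ∧ x + y ≠ 0 ∧
      (if x + y ∈ D then (1 : F) else 0) ≠
        (if x ∈ D then (1 : F) else 0) + (if y ∈ D then (1 : F) else 0)) :
    Function.Injective (codewordMDLinearMap F D) := by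
  rw [← LinearMap.ker_eq_bot, LinearMap.ker_eq_bot']
  rintro ⟨u, v⟩ h
  have h' := (codewordMD_eq_zero_iff hD0).1 h
  simp only at h'
  have hu : u = 0 := by
    by_contra hu
    obtain ⟨x, y, -, -, -, hne⟩ := hnl
    refine hne (mul_left_cancel₀ hu ?_)
    have hxy := h' (x + y)
    rw [mul_add, map_add] at hxy
    linear_combination hxy - h' x - h' y
  subst hu
  refine Prod.ext rfl (by_contra fun hv => ?_)
  obtain ⟨x, hx⟩ := exists_trace_mul_ne_zero (F := F) hv
  have := h' x
  rw [zero_mul, zero_add] at this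
  exact hx this

lemma card_codewordMD_one_zero {D : Finset E} (hD0 : ∀ x ∈ D, x ≠ 0) :
    #{x : {x : E // x ≠ 0} | codewordMD F E D (1, 0) x ≠ 0} = #D := by
  rw [← card_map (Function.Embedding.subtype _)]
  congr 1
  ext x
  simp only [codewordMD, mem_map, mem_filter, mem_univ, true_and, zero_mul, map_zero, add_zero,
    one_mul, Function.Embedding.coe_subtype, Subtype.exists, exists_and_right, exists_eq_right]
  refine ⟨?_, fun hx => ⟨hD0 x hx, by simp [hx]⟩⟩
  rintro ⟨_, hx⟩
  by_contra hD
  exact hx (if_neg hD)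

lemma card_codewordMD_zero_one [Fintype F] {D : Finset E} :
    (#{x : {x : E // x ≠ 0} | codewordMD F E D (0, 1) x ≠ 0} : ℝ) * Fintype.card F =
      (Fintype.card F - 1) * Fintype.card E := by
  rw [← card_trace_mul_ne_zero (one_ne_zero (α := E)),
    ← card_map (Function.Embedding.subtype _)]
  congr 3
  ext x
  simp only [codewordMD, mem_map, mem_filter, mem_univ, true_and, zero_mul, zero_add,
    Function.Embedding.coe_subtype, Subtype.exists, exists_and_right, exists_eq_right]
  refine ⟨fun ⟨_, hx⟩ => hx, fun hx => ⟨?_, hx⟩⟩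
  rintro rfl
  exact hx (by rw [mul_zero, map_zero])

end Codewords

open Finset in
/-- Let `D ⊆ F_{q^m}^*` be a proper `F_q^*`-invariant partial difference set
satisfying the hypotheses of Theorem 3.8 of the paper.  If moreover
`k ≤ (q−1)²q^{m−2}` and `f_D` is not linear, then `C(M_D)` is a minimal linear
code of length `q^m − 1` and dimension `m + 1` whose minimum and maximum
nonzero weights satisfy `w_min/w_max ≤ (q−1)/q`, i.e. `C(M_D)` violates the
Ashikhmin–Barg condition. -/
theorem minimal_code_violating_AB {p e m q : ℕ} [Fact p.Prime] (he : 0 < e) (hm : 0 < m)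
    (hq : q = p ^ e) {F E : Type*} [Field F] [Field E] [Fintype F] [Fintype E]
    [DecidableEq F] [DecidableEq E] [Algebra F E] [CharP E p]
    (hF : Fintype.card F = q) (hE : Fintype.card E = q ^ m)
    (D : Finset E) (hD0 : ∀ x ∈ D, x ≠ 0)
    (hDproper : (D : Set E) ≠ {x : E | x ≠ 0}) (hDneg : ∀ d ∈ D, -d ∈ D)
    (hinv : ∀ l : F, l ≠ 0 → ∀ x ∈ D, algebraMap F E l * x ∈ D)
    (lam mu : ℕ)
    (hpds : ∀ g : E, g ≠ 0 →
      ((D ×ˢ D).filter (fun pr => pr.1 - pr.2 = g)).card = if g ∈ D then lam else mu)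
    (θ1 θ2 : ℝ) (hθ1 : 0 < θ1) (hθ2 : θ2 < 0)
    (heig : ∀ a : E, a ≠ 0 →
      (∑ x ∈ D, canonAddChar p E (a * x)) = (θ1 : ℂ) ∨
        (∑ x ∈ D, canonAddChar p E (a * x)) = (θ2 : ℂ))
    (h1 : (D.card : ℝ) - θ2 ≠ (q : ℝ) ^ m)
    (h2 : (D.card : ℝ) > θ1 ∧ (D.card : ℝ) > -(((q : ℝ) - 1) * θ2))
    (h3 : (D.card : ℝ) < (q : ℝ) ^ m + q * θ2 - ((q : ℝ) - 1) * θ1 ∨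
      (D.card : ℝ) > max (q * max |θ1| |θ2| + θ1) (q * max |θ1| |θ2| - ((q : ℝ) - 1) * θ2) ∨
      (q : ℝ) ^ (m - 1) + θ2 - θ1 > max |θ1| |θ2|)
    (hk : (D.card : ℝ) ≤ ((q : ℝ) - 1) ^ 2 * (q : ℝ) ^ ((m : ℤ) - 2))
    (hnl : ∃ x y : E, x ≠ 0 ∧ y ≠ 0 ∧ x + y ≠ 0 ∧
      (if x + y ∈ D then (1 : F) else 0) ≠
        (if x ∈ D then (1 : F) else 0) + (if y ∈ D then (1 : F) else 0)) :
    (∀ w : F × E, codewordMD F E D w ≠ 0 → ∀ w' : F × E,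
        Function.support (codewordMD F E D w') ⊆ Function.support (codewordMD F E D w) →
          ∃ a : F, codewordMD F E D w' = a • codewordMD F E D w) ∧
    Fintype.card {x : E // x ≠ 0} = q ^ m - 1 ∧
    Module.finrank F (Submodule.span F (Set.range (codewordMD F E D))) = m + 1 ∧
    (∀ wmin wmax : ℕ,
      IsLeast {w : ℕ | w ≠ 0 ∧ ∃ uv : F × E,
        (univ.filter (fun x : {x : E // x ≠ 0} => codewordMD F E D uv x ≠ 0)).card = w} wmin →
      IsGreatest {w : ℕ | w ≠ 0 ∧ ∃ uv : F × E,
        (univ.filter (fun x : {x : E // x ≠ 0} => codewordMD F E D uv x ≠ 0)).card = w} wmax →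
      (wmin : ℚ) / (wmax : ℚ) ≤ ((q : ℚ) - 1) / (q : ℚ)) := by
  classical
  subst hF
  have hq : (1 : ℝ) < Fintype.card F := by exact_mod_cast Fintype.one_lt_card (α := F)
  have hq0 : (Fintype.card F : ℝ) ≠ 0 := by positivity
  have hE' : (Fintype.card F : ℝ) ^ m = Fintype.card E := by rw [hE]; push_cast; rfl
  have hpred : (Fintype.card F : ℝ) ^ (m - 1) = Fintype.card E / Fintype.card F := by
    rw [← hE', pow_sub₀ _ hq0 hm, pow_one, div_eq_mul_inv]
  rw [zpow_sub₀ hq0, zpow_natCast, hE', zpow_ofNat, ← mul_div_assoc,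
    le_div_iff₀ (by positivity), mul_comm] at hk
  rw [hE'] at h1 h3
  rw [hpred] at h3
  obtain ⟨h2, h2'⟩ := h2
  have hcardD : #D < Fintype.card E := by
    refine card_lt_univ_of_notMem (x := 0) fun h => hD0 0 h rfl
  have hcount (w : E) (hw : w ≠ 0) : ∃ θ : ℝ, (θ = θ1 ∨ θ = θ2) ∧
      (Fintype.card F : ℝ) * #{x ∈ D | Algebra.trace F E (w * x) = 0} =
        #D + (Fintype.card F - 1) * θ := by
    rcases heig w hw with h | h
    · exact ⟨θ1, Or.inl rfl, card_mul_card_filter_trace_eq hinv h⟩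
    · exact ⟨θ2, Or.inr rfl, card_mul_card_filter_trace_eq hinv h⟩
  have hinj := codewordMDLinearMap_injective hD0 hnl
  refine ⟨?_, ?_, ?_, ?_⟩
  · rintro ⟨u, v⟩ hw ⟨u', v'⟩ hsupp
    have hsub := codewordMD_support_subset hD0 hsupp
    simp only at hsub
    suffices h : ∃ a : F, ((u', v') : F × E) = a • (u, v) by
      obtain ⟨a, ha⟩ := h
      exact ⟨a, by rw [ha]; exact (codewordMDLinearMap F D).map_smul a (u, v)⟩
    by_cases hu : u = 0
    · subst hu
      have hv : v ≠ 0 := by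
        rintro rfl
        exact hw ((codewordMDLinearMap F D).map_zero)
      simp only [zero_mul, zero_add] at hsub
      have hu' : u' = 0 := by
        by_contra hu'
        obtain ⟨θ, hθ, hn⟩ := hcount v hv
        obtain ⟨x, hx, hx'⟩ := exists_trace_eq_zero_and_codeword_ne_zero (v' := v') hinv hu' hv hn
          (by rcases hθ with rfl | rfl <;> linarith)
          (by rcases hθ with rfl | rfl <;> nlinarith) hk
        exact hx' (hsub x hx)
      subst hu'
      simp only [zero_mul, zero_add] at hsub
      obtain ⟨b, rfl⟩ := exists_eq_algebraMap_mul_of_trace hv hsub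
      exact ⟨b, by simp [Algebra.smul_def]⟩
    · have := eq_zero_of_forall_codeword_eq_zero (v' := v' - (u' / u) • v) hinv hcount hθ1 hθ2
        h2 hcardD h1 (h3.imp_right (Or.imp_left fun h => (le_max_left _ _).trans_lt h)) hu
        fun x hx => by
          have hx' := hsub x hx
          rw [sub_mul, map_sub, smul_mul_assoc, map_smul, smul_eq_mul]
          refine mul_left_cancel₀ hu ?_
          linear_combination u * hx' - u' * hx -
            Algebra.trace F E (v * x) * div_mul_cancel₀ u' hu
      refine ⟨u' / u, Prod.ext ?_ (sub_eq_zero.1 this)⟩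
      simp [hu]
  · rw [Fintype.card_subtype_compl, Fintype.card_subtype_eq, hE]
  · have hm' : Module.finrank F E = m :=
      Nat.pow_right_injective (Fintype.one_lt_card (α := F))
        ((Module.card_eq_pow_finrank (K := F) (V := E)).symm.trans hE)
    change Module.finrank F (Submodule.span F (Set.range (codewordMDLinearMap F D))) = _
    rw [← LinearMap.coe_range, Submodule.span_eq, LinearMap.finrank_range_of_inj hinj,
      Module.finrank_prod, Module.finrank_self, hm', add_comm]
  · intro wmin wmax hmin hmax
    have hkpos : (0 : ℝ) < #D := hθ1.trans h2
    have hle : wmin ≤ #D := hmin.2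
      ⟨by exact_mod_cast hkpos.ne', (1, 0), card_codewordMD_one_zero hD0⟩
    have hone := card_codewordMD_zero_one (F := F) (D := D)
    have hQ : (0 : ℝ) < Fintype.card E := by exact_mod_cast Fintype.card_pos (α := E)
    have hge : #{x : {x : E // x ≠ 0} | codewordMD F E D (0, 1) x ≠ 0} ≤ wmax :=
      hmax.2 ⟨fun h0 => by
        rw [h0, Nat.cast_zero, zero_mul] at hone
        exact (mul_pos (sub_pos.2 hq) hQ).ne hone, (0, 1), rfl⟩
    have hmaxpos : 0 < wmax := Nat.pos_of_ne_zero hmax.1.1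
    rw [div_le_div_iff₀ (by exact_mod_cast hmaxpos) (by exact_mod_cast Fintype.card_pos)]
    suffices h : (wmin : ℝ) * Fintype.card F ≤ (Fintype.card F - 1) * wmax by exact_mod_cast h
    rify at hle hge
    refine le_of_mul_le_mul_left ?_ (zero_lt_one.trans hq)
    calc (Fintype.card F : ℝ) * (wmin * Fintype.card F) ≤ Fintype.card F ^ 2 * #D := by
          nlinarith [mul_le_mul_of_nonneg_left hle (sq_nonneg (Fintype.card F : ℝ))]
      _ ≤ (Fintype.card F - 1) ^ 2 * Fintype.card E := hk
      _ = Fintype.card F * ((Fintype.card F - 1) *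
            #{x : {x : E // x ≠ 0} | codewordMD F E D (0, 1) x ≠ 0}) := by
          linear_combination (1 - (Fintype.card F : ℝ)) * hone
      _ ≤ Fintype.card F * ((Fintype.card F - 1) * wmax) := by
          have := sub_pos.2 hq
          gcongr
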